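/- arXiv:0901.3322 — 5 statements merged into one kernel-verified Lean document; each statement's English description precedes it below -/
import Mathlib

section
/- Let A be a nilpotent endomorphism of ℂⁿ of Jordan type λ, i.e., dim ker(Aⁱ) = λ'₁ + ⋯ + λ'ᵢ for all i, where λ' is the conjugate partition of λ. Set r = λ₁ and mᵢ = λ'₁ + ⋯ + λ'ᵢ. If 0 = F₀ ⊆ F₁ ⊆ ⋯ ⊆ F_r = ℂⁿ is a chain of subspaces with dim Fᵢ = mᵢ and A(Fᵢ) ⊆ F_{i−1} for all 1 ≤ i ≤ r, then Fᵢ = ker(Aⁱ) for all i. In particular such a chain is unique. -/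
/-- Uniqueness of the flag associated to a nilpotent endomorphism of given
Jordan type.

A partition `λ` of `n` is modelled as an antitone function `f : ℕ → ℕ` with
finite support summing to `n`; its conjugate has `j`-th part (0-indexed)
`#{l : f l > j}`, and `mᵢ = λ'₁ + ⋯ + λ'ᵢ = ∑_{j<i} #{l : f l > j}`.
If `A` is an endomorphism of `ℂⁿ` of Jordan type `λ` (i.e.
`dim ker(Aⁱ) = mᵢ` for all `i`), `r = λ₁ = f 0`, and
`0 = F₀ ⊆ F₁ ⊆ ⋯ ⊆ F_r = ℂⁿ` is a chain of subspaces with `dim Fᵢ = mᵢ` and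
`A(Fᵢ) ⊆ F_{i-1}` for `1 ≤ i ≤ r`, then `Fᵢ = ker(Aⁱ)` for all `i ≤ r`. -/
theorem flag_of_jordan_type_unique
    (n : ℕ) (f : ℕ → ℕ) (hf : Antitone f)
    (hfs : (Function.support f).Finite) (hfn : ∑ᶠ i, f i = n)
    (A : Module.End ℂ (Fin n → ℂ))
    (hA : ∀ i, Module.finrank ℂ (LinearMap.ker (A ^ i)) =
      ∑ j ∈ Finset.range i, Set.ncard {l | j < f l})
    (F : ℕ → Submodule ℂ (Fin n → ℂ))
    (hF0 : F 0 = ⊥) (hFr : F (f 0) = ⊤)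
    (hdim : ∀ i ≤ f 0, Module.finrank ℂ (F i) =
      ∑ j ∈ Finset.range i, Set.ncard {l | j < f l})
    (hmono : ∀ i < f 0, F i ≤ F (i + 1))
    (hmap : ∀ i, 1 ≤ i → i ≤ f 0 → Submodule.map A (F i) ≤ F (i - 1)) :
    ∀ i ≤ f 0, F i = LinearMap.ker (A ^ i) := by
  have key : ∀ i ≤ f 0, F i ≤ LinearMap.ker (A ^ i) := by
    intro i
    induction i with
    | zero => intro _; rw [hF0]; exact bot_le
    | succ k ih =>
      intro hk x hx
      have h1 : A x ∈ F k := hmap (k + 1) (by omega) hk (Submodule.mem_map_of_mem hx)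
      have h2 := ih (by omega) h1
      rw [LinearMap.mem_ker] at h2 ⊢
      rw [pow_succ]
      exact h2
  intro i hi
  exact Submodule.eq_of_le_of_finrank_eq (key i hi) ((hdim i hi).trans (hA i).symm)
end

section
/- Let λ be a partition of n with conjugate partition λ', set r = λ₁ and mᵢ = λ'₁ + ⋯ + λ'ᵢ. Then the set of matrices A ∈ Mₙ(ℂ) admitting a chain of subspaces 0 = F₀ ⊆ F₁ ⊆ ⋯ ⊆ F_r = ℂⁿ with dim Fᵢ = mᵢ and A(Fᵢ) ⊆ F_{i−1} for all 1 ≤ i ≤ r is equal to the closure, in the standard topology on Mₙ(ℂ), of the set O_λ of nilpotent matrices of Jordan type λ. (This is the statement that the image of the generalized Springer map π_{P_{λ'}} : T*(G/P_{λ'}) → 𝔰𝔩ₙ is the closure of the Richardson orbit O_λ.) -/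
theorem rel_compl {V : Type*} [AddCommGroup V] [Module ℂ V] [FiniteDimensional ℂ V]
    (E E' : Submodule ℂ V) (h : E ≤ E') : ∃ C W : Submodule ℂ V, IsCompl E C ∧ W ≤ C ∧ W ≤ E' ∧
      E ⊔ W = E' ∧ Module.finrank ℂ E + Module.finrank ℂ W = Module.finrank ℂ E' := by
  obtain ⟨C, hC⟩ := exists_isCompl E
  have h1 : E ⊔ (C ⊓ E') = E' := by
    rw [← sup_inf_assoc_of_le C h, hC.sup_eq_top, top_inf_eq]
  refine ⟨C, C ⊓ E', hC, inf_le_left, inf_le_right, h1, ?_⟩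
  have h2 := Submodule.finrank_sup_add_finrank_inf_eq E (C ⊓ E')
  have h3 : E ⊓ (C ⊓ E') = ⊥ := by
    rw [← inf_assoc, hC.inf_eq_bot, bot_inf_eq]
  rw [h1, h3, finrank_bot] at h2
  omega

theorem step_map {V : Type*} [AddCommGroup V] [Module ℂ V] [FiniteDimensional ℂ V]
    (E0 E1 E2 : Submodule ℂ V) (h01 : E0 ≤ E1) (h12 : E1 ≤ E2)
    (hd : Module.finrank ℂ E2 + Module.finrank ℂ E0 ≤ Module.finrank ℂ E1 + Module.finrank ℂ E1) :
    ∃ g : V →ₗ[ℂ] V, (∀ x, g x ∈ E1) ∧ (∀ x ∈ E1, g x = 0) ∧ ∀ x ∈ E2, g x ∈ E0 → x ∈ E1 := by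
  obtain ⟨C, W, hC, hWC, hWE, hs, hdW⟩ := rel_compl E1 E2 h12
  obtain ⟨C', W', hC', hWC', hWE', hs', hdW'⟩ := rel_compl E0 E1 h01
  obtain ⟨j, hj⟩ := (finrank_le_iff_exists_linearMap (R := ℂ) (M := W) (M' := W')).1 (by omega)
  obtain ⟨k, hk⟩ := LinearMap.exists_extend j
  have hk' : ∀ w : W, k w = j w := fun w => by rw [← hk]; rfl
  refine ⟨W'.subtype ∘ₗ k ∘ₗ (C.projection E1 hC.symm), fun x => hWE' (k _).2, fun x hx => ?_, fun x hx hg => ?_⟩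
  · have : C.projection E1 hC.symm x = 0 := by simpa using hx
    simp [this]
  · rw [← hs] at hx
    obtain ⟨a, ha, w, hw, rfl⟩ := Submodule.mem_sup.1 hx
    have e1 : C.projection E1 hC.symm a = 0 := by simpa using ha
    have e2 : C.projection E1 hC.symm w = w := by
      simpa using hWC hw
    have e3 : k w = j ⟨w, hw⟩ := hk' ⟨w, hw⟩
    simp only [LinearMap.comp_apply, map_add, e1, e2, map_zero, zero_add, e3, Submodule.subtype_apply, ZeroMemClass.coe_zero] at hg
    have e4 : ((j ⟨w, hw⟩ : W') : V) = 0 :=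
      (Submodule.disjoint_def.1 hC'.disjoint) _ hg (hWC' (j ⟨w, hw⟩).2)
    have e5 : j ⟨w, hw⟩ = 0 := Subtype.ext e4
    have e6 : (⟨w, hw⟩ : W) = 0 := hj (by rw [e5, map_zero])
    have e7 : w = 0 := congrArg Subtype.val e6
    rw [e7, add_zero]; exact ha

theorem exists_generic {V : Type*} [AddCommGroup V] [Module ℂ V] [FiniteDimensional ℂ V]
    (r : ℕ) (F : ℕ → Submodule ℂ V) (h0 : F 0 = ⊥) (hr : F r = ⊤)
    (hmono : ∀ i < r, F i ≤ F (i + 1))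
    (hd : ∀ i, 1 ≤ i → i < r → Module.finrank ℂ (F (i+1)) + Module.finrank ℂ (F (i-1)) ≤
      Module.finrank ℂ (F i) + Module.finrank ℂ (F i)) :
    ∃ N : V →ₗ[ℂ] V, (∀ i < r, ∀ x ∈ F (i+1), N x ∈ F i) ∧
      ∀ i ≤ r, ∀ x, (N ^ i) x = 0 → x ∈ F i := by
  have hm : ∀ i j, i ≤ j → j ≤ r → F i ≤ F j := by
    intro i j hij
    induction j, hij using Nat.le_induction with
    | base => intro _; exact le_rfl
    | succ j hij ih => intro hj; exact (ih (by omega)).trans (hmono j (by omega))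
  have hg : ∀ i, ∃ g : V →ₗ[ℂ] V, 1 ≤ i → i < r → (∀ x, g x ∈ F i) ∧ (∀ x ∈ F i, g x = 0) ∧
      ∀ x ∈ F (i+1), g x ∈ F (i-1) → x ∈ F i := by
    intro i
    by_cases hi : 1 ≤ i ∧ i < r
    · obtain ⟨g, hg⟩ := step_map (F (i-1)) (F i) (F (i+1)) (hm _ _ (by omega) (by omega))
        (hm _ _ (by omega) (by omega)) (hd i hi.1 hi.2)
      exact ⟨g, fun _ _ => hg⟩
    · exact ⟨0, fun a b => absurd ⟨a, b⟩ hi⟩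
  choose g hg using hg
  have hmem : ∀ j, 1 ≤ j → j < r → ∀ i < r, ∀ x ∈ F (i+1), g j x ∈ F i := by
    intro j hj hjr i hi x hx
    by_cases hij : i + 1 ≤ j
    · rw [(hg j hj hjr).2.1 x (hm _ _ hij (by omega) hx)]; exact zero_mem _
    · exact hm j i (by omega) (by omega) ((hg j hj hjr).1 x)
  let N : V →ₗ[ℂ] V := ∑ j ∈ Finset.Ico 1 r, g j
  have hN : ∀ x, N x = ∑ j ∈ Finset.Ico 1 r, g j x := fun x => by simp [N]
  have key : ∀ i, 1 ≤ i → i < r → ∀ x ∈ F (i+1), N x ∈ F (i-1) → x ∈ F i := by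
    intro i hi hir x hx hNx
    apply (hg i hi hir).2.2 x hx
    rw [hN, ← Finset.add_sum_erase _ _ (Finset.mem_Ico.2 ⟨hi, hir⟩)] at hNx
    refine (Submodule.add_mem_iff_left _ (Submodule.sum_mem _ fun j hj => ?_)).1 hNx
    simp only [Finset.mem_erase, Finset.mem_Ico] at hj
    rcases lt_or_gt_of_ne hj.1 with h | h
    · exact hm j (i-1) (by omega) (by omega) ((hg j hj.2.1 hj.2.2).1 x)
    · rw [(hg j hj.2.1 hj.2.2).2.1 x (hm _ _ h (by omega) hx)]; exact zero_mem _
  refine ⟨N, fun i hi x hx => ?_, fun i => ?_⟩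
  · rw [hN]
    refine Submodule.sum_mem _ fun j hj => ?_
    rw [Finset.mem_Ico] at hj
    exact hmem j hj.1 hj.2 i hi x hx
  · induction i with
    | zero => intro _ x hx; simpa [h0] using hx
    | succ i ih =>
      intro hi x hx
      have hNx : N x ∈ F i := ih (by omega) _ (by rw [pow_succ] at hx; exact hx)
      have : ∀ d k, k + d = r → i + 1 ≤ k → x ∈ F k := by
        intro d
        induction d with
        | zero => intro k hk _; obtain rfl : k = r := by omega
                  rw [hr]; trivial
        | succ d ihd =>
          intro k hk hik
          exact key k (by omega) (by omega) x (ihd (k+1) (by omega) (by omega))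
            (hm i (k-1) (by omega) (by omega) hNx)
      exact this (r - (i+1)) (i+1) (by omega) le_rfl

theorem generic_rank {n : ℕ} (A N : Matrix (Fin n) (Fin n) ℂ) (i : ℕ) :
    ∃ S : Set ℂ, S.Finite ∧ ∀ t ∉ S,
      Module.finrank ℂ (LinearMap.ker ((A + t • (N - A)).mulVecLin ^ i)) ≤
        Module.finrank ℂ (LinearMap.ker (N.mulVecLin ^ i)) := by
  have hpow : ∀ B : Matrix (Fin n) (Fin n) ℂ, B.mulVecLin ^ i = (B ^ i).mulVecLin :=
    fun B => (Matrix.toLin'_pow B i).symm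
  set M := N.mulVecLin ^ i with hM
  obtain ⟨s, hs⟩ := LinearMap.exists_rightInverse_of_surjective M.rangeRestrict
    (LinearMap.range_rangeRestrict M)
  obtain ⟨l, hl⟩ := LinearMap.exists_extend s
  have hMl : ∀ x, M (l (M x)) = M x := by
    intro x
    have e1 : l (M x) = s (M.rangeRestrict x) := by rw [← hl]; rfl
    have e2 := LinearMap.congr_fun hs (M.rangeRestrict x)
    rw [e1]
    exact congrArg Subtype.val e2
  let L : Matrix (Fin n) (Fin n) ℂ := LinearMap.toMatrix' l
  have hL : L.mulVecLin = l := Matrix.toLin'_toMatrix' l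
  let P : Matrix (Fin n) (Fin n) ℂ := 1 - L * N ^ i
  have hP : LinearMap.range P.mulVecLin ≤ LinearMap.ker M := by
    rintro _ ⟨x, rfl⟩
    have : P.mulVecLin x = x - l (M x) := by
      rw [← hL, hM, hpow]
      simp [P, Matrix.sub_mulVec, Matrix.mulVec_mulVec]
    rw [this, LinearMap.mem_ker, map_sub, hMl, sub_self]
  open Polynomial in
  let D : Polynomial ℂ := (L.map C * (A.map C + (X : ℂ[X]) • (N - A).map C) ^ i + P.map C).det
  have hD : ∀ t, D.eval t = (L * (A + t • (N - A)) ^ i + P).det := by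
    intro t
    have h1 : ∀ B : Matrix (Fin n) (Fin n) ℂ,
        (Polynomial.evalRingHom t).mapMatrix (B.map Polynomial.C) = B := by
      intro B; ext a b; simp
    have h2 : (Polynomial.evalRingHom t).mapMatrix
        ((Polynomial.X : Polynomial ℂ) • (N - A).map Polynomial.C) = t • (N - A) := by
      ext a b; simp
    rw [← Polynomial.coe_evalRingHom, RingHom.map_det, map_add, map_mul, map_pow, map_add,
      h1, h1, h1, h2]
  have hD0 : D ≠ 0 := by
    intro h
    have := hD 1
    rw [h] at this
    simp [P] at this
  refine ⟨{t | D.IsRoot t}, Polynomial.finite_setOfPred_isRoot hD0, fun t ht => ?_⟩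
  set B := A + t • (N - A) with hB
  have hdet : (L * B ^ i + P).det ≠ 0 := by rw [← hD]; exact ht
  have hdisj : LinearMap.ker (B.mulVecLin ^ i) ⊓ LinearMap.ker P.mulVecLin = ⊥ := by
    rw [eq_bot_iff]
    rintro x ⟨hx1, hx2⟩
    rw [hpow] at hx1
    have hx1 : (B ^ i).mulVec x = 0 := hx1
    have hx2 : P.mulVec x = 0 := hx2
    have : (L * B ^ i + P).mulVec x = 0 := by
      rw [Matrix.add_mulVec, ← Matrix.mulVec_mulVec, hx1, hx2]; simp
    exact Matrix.eq_zero_of_mulVec_eq_zero hdet this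
  have d1 := Submodule.finrank_sup_add_finrank_inf_eq (LinearMap.ker (B.mulVecLin ^ i))
    (LinearMap.ker P.mulVecLin)
  rw [hdisj, finrank_bot] at d1
  have d2 := Submodule.finrank_le (LinearMap.ker (B.mulVecLin ^ i) ⊔ LinearMap.ker P.mulVecLin)
  have d3 := LinearMap.finrank_range_add_finrank_ker P.mulVecLin
  have d4 := Submodule.finrank_mono hP
  omega

theorem proj_exists {n : ℕ} (F : Submodule ℂ (Fin n → ℂ)) :
    ∃ P : Matrix (Fin n) (Fin n) ℂ, (∀ x, P.mulVec x ∈ F) ∧ (∀ x ∈ F, P.mulVec x = x) ∧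
      ∀ i j, ‖P i j‖ ≤ 1 := by
  let e := WithLp.linearEquiv 2 ℂ (Fin n → ℂ)
  let F' := F.comap e.toLinearMap
  let p : (Fin n → ℂ) →ₗ[ℂ] (Fin n → ℂ) :=
    e.toLinearMap ∘ₗ F'.starProjection.toLinearMap ∘ₗ e.symm.toLinearMap
  have hp : ∀ x, (LinearMap.toMatrix' p).mulVec x = e (F'.starProjection (e.symm x)) := by
    intro x; rw [LinearMap.toMatrix'_mulVec]; rfl
  refine ⟨LinearMap.toMatrix' p, fun x => ?_, fun x hx => ?_, fun i j => ?_⟩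
  · rw [hp]; exact F'.starProjection_apply_mem _
  · rw [hp, Submodule.starProjection_eq_self_iff.2]
    · simp
    · simpa [F'] using hx
  · have h1 : LinearMap.toMatrix' p i j = F'.starProjection (EuclideanSpace.single j 1) i := by
      rw [LinearMap.toMatrix'_apply]; rfl
    rw [h1]
    refine (PiLp.norm_apply_le _ _).trans ((F'.norm_starProjection_apply_le _).trans ?_)
    simp

theorem numeric (n : ℕ) (f : ℕ → ℕ) (hf : Antitone f)
    (hfs : (Function.support f).Finite) (hfn : ∑ᶠ i, f i = n) :
    ∑ j ∈ Finset.range (f 0), Set.ncard {l | j < f l} = n := by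
  rw [finsum_eq_sum_of_support_subset f (s := hfs.toFinset) (by simp)] at hfn
  have h1 : ∀ j, Set.ncard {l | j < f l} = ∑ l ∈ hfs.toFinset, if j < f l then 1 else 0 := by
    intro j
    rw [← Finset.card_filter, ← Set.ncard_coe_finset]
    congr 1
    ext l
    simp only [Set.mem_ofPred_eq, Finset.coe_filter, Set.Finite.mem_toFinset, Function.mem_support]
    omega
  simp_rw [h1]
  rw [Finset.sum_comm, ← hfn]
  refine Finset.sum_congr rfl fun l _ => ?_
  rw [← Finset.card_filter]
  have : Finset.filter (fun j => j < f l) (Finset.range (f 0)) = Finset.range (f l) := by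
    ext j
    have := hf (Nat.zero_le l)
    simp only [Finset.mem_filter, Finset.mem_range]
    omega
  rw [this, Finset.card_range]

theorem conj_antitone (f : ℕ → ℕ) (hfs : (Function.support f).Finite) (i j : ℕ) (hij : i ≤ j) :
    Set.ncard {l | j < f l} ≤ Set.ncard {l | i < f l} := by
  refine Set.ncard_le_ncard (fun l hl => ?_) (hfs.subset fun l hl => ?_)
  · exact lt_of_le_of_lt hij hl
  · have : i < f l := hl
    rw [Function.mem_support]; omega

theorem conj_zero (f : ℕ → ℕ) (hf : Antitone f) (j : ℕ) (hj : f 0 ≤ j) :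
    Set.ncard {l | j < f l} = 0 := by
  have : {l | j < f l} = ∅ := by
    ext l
    have := hf (Nat.zero_le l)
    simp only [Set.mem_ofPred_eq, Set.mem_empty_iff_false, iff_false]
    omega
  rw [this, Set.ncard_empty]

theorem conj_sum_stable (f : ℕ → ℕ) (hf : Antitone f) (i : ℕ) (hi : f 0 ≤ i) :
    ∑ j ∈ Finset.range i, Set.ncard {l | j < f l} =
      ∑ j ∈ Finset.range (f 0), Set.ncard {l | j < f l} := by
  induction i, hi using Nat.le_induction with
  | base => rfl
  | succ i hi ih => rw [Finset.sum_range_succ, ih, conj_zero f hf i hi, add_zero]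

theorem proj_isProj {n : ℕ} (P : Matrix (Fin n) (Fin n) ℂ) (F : Submodule ℂ (Fin n → ℂ))
    (h1 : ∀ x, P.mulVec x ∈ F) (h2 : ∀ x ∈ F, P.mulVec x = x) :
    P.trace = (Module.finrank ℂ F : ℂ) := by
  have h : LinearMap.IsProj F (Matrix.toLin' P) := ⟨h1, h2⟩
  rw [← h.trace, Matrix.trace_toLin'_eq]

theorem mul_eq_of_mulVec {n : ℕ} (A B : Matrix (Fin n) (Fin n) ℂ)
    (h : ∀ x, A.mulVec x = B.mulVec x) : A = B := by
  apply Matrix.toLin'.injective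
  ext1 x
  exact LinearMap.ext h |> fun h' => by rw [show Matrix.toLin' A = Matrix.toLin' B from h']

/-- The flag condition is closed. -/
theorem flag_closed (n r : ℕ) (m : ℕ → ℕ) :
    IsClosed {A : Matrix (Fin n) (Fin n) ℂ |
      ∃ F : ℕ → Submodule ℂ (Fin n → ℂ),
        F 0 = ⊥ ∧ F r = ⊤ ∧
        (∀ i ≤ r, Module.finrank ℂ (F i) = m i) ∧
        (∀ i < r, F i ≤ F (i + 1)) ∧
        (∀ i, 1 ≤ i → i ≤ r → Submodule.map A.mulVecLin (F i) ≤ F (i - 1))} := by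
  let K : Set (ℕ → Matrix (Fin n) (Fin n) ℂ) :=
    Set.pi Set.univ fun _ => Set.pi Set.univ fun _ => Set.pi Set.univ fun _ => Metric.closedBall 0 1
  have hK : IsCompact K := isCompact_univ_pi fun _ => isCompact_univ_pi fun _ =>
    isCompact_univ_pi fun _ => isCompact_closedBall 0 1
  have : CompactSpace K := isCompact_iff_compactSpace.1 hK
  let T : Set (Matrix (Fin n) (Fin n) ℂ × K) := {q |
    q.2.1 0 = 0 ∧ q.2.1 r = 1 ∧
    (∀ i ≤ r, q.2.1 i * q.2.1 i = q.2.1 i) ∧ (∀ i ≤ r, (q.2.1 i).trace = (m i : ℂ)) ∧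
    (∀ i < r, q.2.1 (i+1) * q.2.1 i = q.2.1 i) ∧
    (∀ i, 1 ≤ i → i ≤ r → q.2.1 (i-1) * (q.1 * q.2.1 i) = q.1 * q.2.1 i)}
  have hc : ∀ i, Continuous fun q : Matrix (Fin n) (Fin n) ℂ × K => q.2.1 i := fun i =>
    (continuous_apply i).comp (continuous_subtype_val.comp continuous_snd)
  have hc1 : Continuous fun q : Matrix (Fin n) (Fin n) ℂ × K => q.1 := continuous_fst
  have hT : IsClosed T := by
    refine (isClosed_eq (hc 0) continuous_const).inter ?_
    refine (isClosed_eq (hc r) continuous_const).inter ?_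
    refine IsClosed.inter (s₁ := {q : Matrix (Fin n) (Fin n) ℂ × K | ∀ i ≤ r, q.2.1 i * q.2.1 i = q.2.1 i}) ?_ ?_
    · simp only [Set.ofPred_forall]
      exact isClosed_iInter fun i => isClosed_iInter fun _ =>
        isClosed_eq ((hc i).matrix_mul (hc i)) (hc i)
    refine IsClosed.inter (s₁ := {q : Matrix (Fin n) (Fin n) ℂ × K | ∀ i ≤ r, (q.2.1 i).trace = (m i : ℂ)}) ?_ ?_
    · simp only [Set.ofPred_forall]
      exact isClosed_iInter fun i => isClosed_iInter fun _ =>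
        isClosed_eq ((hc i).matrix_trace) continuous_const
    refine IsClosed.inter (s₁ := {q : Matrix (Fin n) (Fin n) ℂ × K | ∀ i < r, q.2.1 (i+1) * q.2.1 i = q.2.1 i}) ?_ ?_
    · simp only [Set.ofPred_forall]
      exact isClosed_iInter fun i => isClosed_iInter fun _ =>
        isClosed_eq ((hc (i+1)).matrix_mul (hc i)) (hc i)
    · change IsClosed {q : Matrix (Fin n) (Fin n) ℂ × K | ∀ i, 1 ≤ i → i ≤ r →
        q.2.1 (i-1) * (q.1 * q.2.1 i) = q.1 * q.2.1 i}
      simp only [Set.ofPred_forall]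
      exact isClosed_iInter fun i => isClosed_iInter fun _ => isClosed_iInter fun _ =>
        isClosed_eq ((hc (i-1)).matrix_mul (hc1.matrix_mul (hc i))) (hc1.matrix_mul (hc i))
  have hcl := isClosedMap_fst_of_compactSpace T hT
  convert hcl using 1
  ext A
  constructor
  · rintro ⟨F, h0, hr, hd, hmono, hA⟩
    choose P hP1 hP2 hP3 using fun i => proj_exists (F i)
    have hPK : P ∈ K := by
      intro k _ i _ j _
      rw [mem_closedBall_zero_iff]
      exact hP3 k i j
    refine ⟨(A, ⟨P, hPK⟩), ⟨?_, ?_, ?_, ?_, ?_, ?_⟩, rfl⟩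
    · refine mul_eq_of_mulVec _ _ fun x => ?_
      have := hP1 0 x
      rw [h0, Submodule.mem_bot] at this
      simpa using this
    · refine mul_eq_of_mulVec _ _ fun x => ?_
      have := hP2 r x (by rw [hr]; trivial)
      simpa using this
    · intro i _
      refine mul_eq_of_mulVec _ _ fun x => ?_
      rw [← Matrix.mulVec_mulVec]
      exact hP2 i _ (hP1 i x)
    · intro i hi
      rw [← hd i hi]
      exact proj_isProj _ _ (hP1 i) (hP2 i)
    · intro i hi
      refine mul_eq_of_mulVec _ _ fun x => ?_
      rw [← Matrix.mulVec_mulVec]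
      exact hP2 (i+1) _ (hmono i hi (hP1 i x))
    · intro i h1 hi
      refine mul_eq_of_mulVec _ _ fun x => ?_
      rw [← Matrix.mulVec_mulVec]
      refine hP2 (i-1) _ (hA i h1 hi ?_)
      rw [← Matrix.mulVec_mulVec]
      exact ⟨_, hP1 i x, rfl⟩
  · rintro ⟨⟨A', P, hPK⟩, ⟨h0, hr, hid, htr, hmono, hA⟩, rfl⟩
    dsimp only at h0 hr hid htr hmono hA
    refine ⟨fun i => LinearMap.range (P i).mulVecLin, ?_, ?_, ?_, ?_, ?_⟩
    · simp [h0]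
    · simp [hr]
    · intro i hi
      have h := proj_isProj (P i) (LinearMap.range (P i).mulVecLin) (fun x => ⟨x, rfl⟩) (by
        rintro _ ⟨x, rfl⟩
        rw [Matrix.mulVecLin_apply, Matrix.mulVec_mulVec, hid i hi])
      rw [htr i hi] at h
      exact_mod_cast h.symm
    · rintro i hi _ ⟨x, rfl⟩
      refine ⟨(P i).mulVec x, ?_⟩
      rw [Matrix.mulVecLin_apply, Matrix.mulVec_mulVec, hmono i hi, Matrix.mulVecLin_apply]
    · rintro i h1 hi _ ⟨_, ⟨x, rfl⟩, rfl⟩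
      refine ⟨(A' * P i).mulVec x, ?_⟩
      rw [Matrix.mulVecLin_apply, Matrix.mulVec_mulVec, hA i h1 hi, Matrix.mulVecLin_apply,
        Matrix.mulVecLin_apply, Matrix.mulVec_mulVec]

/-- A map lowering the flag has large kernels of powers. -/
theorem flag_ker {V : Type*} [AddCommGroup V] [Module ℂ V]
    (r : ℕ) (F : ℕ → Submodule ℂ V) (h0 : F 0 = ⊥) (N : V →ₗ[ℂ] V)
    (hN : ∀ i < r, ∀ x ∈ F (i+1), N x ∈ F i) : ∀ i ≤ r, F i ≤ LinearMap.ker (N ^ i) := by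
  intro i
  induction i with
  | zero => intro _; rw [h0]; exact bot_le
  | succ i ih =>
    intro hi x hx
    rw [LinearMap.mem_ker, pow_succ]
    exact ih (by omega) (hN i (by omega) x hx)


/-- The image of the generalized Springer map `π_{P_{λ'}} : T*(G/P_{λ'}) → 𝔰𝔩ₙ`
is the closure of the Richardson orbit `O_λ`.

A partition `λ` of `n` is modelled as an antitone function `f : ℕ → ℕ` with
finite support summing to `n`, with conjugate partial sums
`mᵢ = ∑_{j<i} #{l : f l > j}` and `r = λ₁ = f 0`.  The set of matrices
`A ∈ Mₙ(ℂ)` admitting a chain of subspaces `0 = F₀ ⊆ ⋯ ⊆ F_r = ℂⁿ` with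
`dim Fᵢ = mᵢ` and `A(Fᵢ) ⊆ F_{i-1}` equals the closure (standard topology) of
the set `O_λ` of nilpotent matrices of Jordan type `λ`, i.e. those `A` with
`dim ker(Aⁱ) = mᵢ` for all `i`. -/
theorem richardson_orbit_closure
    (n : ℕ) (hn : 1 ≤ n) (f : ℕ → ℕ) (hf : Antitone f)
    (hfs : (Function.support f).Finite) (hfn : ∑ᶠ i, f i = n) :
    {A : Matrix (Fin n) (Fin n) ℂ |
      ∃ F : ℕ → Submodule ℂ (Fin n → ℂ),
        F 0 = ⊥ ∧ F (f 0) = ⊤ ∧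
        (∀ i ≤ f 0, Module.finrank ℂ (F i) =
          ∑ j ∈ Finset.range i, Set.ncard {l | j < f l}) ∧
        (∀ i < f 0, F i ≤ F (i + 1)) ∧
        (∀ i, 1 ≤ i → i ≤ f 0 → Submodule.map A.mulVecLin (F i) ≤ F (i - 1))} =
    closure {A : Matrix (Fin n) (Fin n) ℂ |
      ∀ i, Module.finrank ℂ (LinearMap.ker (A.mulVecLin ^ i)) =
        ∑ j ∈ Finset.range i, Set.ncard {l | j < f l}} := by
  apply Set.Subset.antisymm
  · rintro A ⟨F, h0, hr, hd, hmono, hA⟩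
    set m : ℕ → ℕ := fun i => ∑ j ∈ Finset.range i, Set.ncard {l | j < f l} with hm
    have hA' : ∀ i < f 0, ∀ x ∈ F (i+1), A.mulVecLin x ∈ F i := fun i hi x hx =>
      hA (i+1) (by omega) (by omega) ⟨x, hx, rfl⟩
    obtain ⟨N', hN1, hN2⟩ := exists_generic (f 0) F h0 hr hmono (by
      intro i h1 hi
      rw [hd _ (by omega), hd _ (by omega), hd _ (by omega)]
      obtain ⟨k, rfl⟩ : ∃ k, i = k + 1 := ⟨i - 1, by omega⟩
      have := conj_antitone f hfs k (k+1) (by omega)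
      simp only [Nat.add_sub_cancel, Finset.sum_range_succ]
      omega)
    obtain ⟨N, rfl⟩ : ∃ N : Matrix (Fin n) (Fin n) ℂ, N.mulVecLin = N' :=
      ⟨LinearMap.toMatrix' N', Matrix.toLin'_toMatrix' N'⟩
    choose S hSf hS using fun i => generic_rank A N i
    have hfin : (⋃ i ∈ Finset.range (f 0 + 1), S i).Finite :=
      Set.Finite.biUnion (Finset.finite_toSet _) fun i _ => hSf i
    have hdense := hfin.countable.dense_compl ℂ
    have hcont : Continuous fun t : ℂ => A + t • (N - A) := by fun_prop
    have hmem := map_mem_closure hcont (hdense 0) (t := {A : Matrix (Fin n) (Fin n) ℂ |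
      ∀ i, Module.finrank ℂ (LinearMap.ker (A.mulVecLin ^ i)) = m i}) (by
      intro t ht
      have hB : ∀ i < f 0, ∀ x ∈ F (i+1), (A + t • (N - A)).mulVecLin x ∈ F i := by
        intro i hi x hx
        have e : (A + t • (N - A)).mulVecLin x =
            A.mulVecLin x + t • (N.mulVecLin x - A.mulVecLin x) := by
          simp [Matrix.add_mulVec, Matrix.smul_mulVec, Matrix.sub_mulVec]
        rw [e]
        exact add_mem (hA' i hi x hx) (Submodule.smul_mem _ _
          (sub_mem (hN1 i hi x hx) (hA' i hi x hx)))
      have hBk := flag_ker (f 0) F h0 _ hB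
      have hle : ∀ i ≤ f 0,
          Module.finrank ℂ (LinearMap.ker ((A + t • (N - A)).mulVecLin ^ i)) = m i := by
        intro i hi
        apply le_antisymm
        · refine (hS i t fun hti => ht ?_).trans ?_
          · exact Set.mem_biUnion (by simpa using Nat.lt_succ_of_le hi) hti
          · refine le_of_le_of_eq ?_ (hd i hi)
            exact Submodule.finrank_mono fun x hx => hN2 i hi x hx
        · refine le_of_eq_of_le (hd i hi).symm ?_
          exact Submodule.finrank_mono (hBk i hi)
      intro i
      rcases le_total i (f 0) with hi | hi
      · exact hle i hi
      · have h1 : m i = m (f 0) := conj_sum_stable f hf i hi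
        rw [h1, ← hle _ le_rfl]
        have h2 := hBk _ le_rfl
        rw [hr, top_le_iff] at h2
        have h3 : LinearMap.ker ((A + t • (N - A)).mulVecLin ^ i) = ⊤ := by
          rw [LinearMap.ker_eq_top] at h2 ⊢
          exact pow_eq_zero_of_le hi h2
        rw [h2, h3])
    simpa using hmem
  · refine closure_minimal ?_ (flag_closed n (f 0) _)
    intro A hA
    refine ⟨fun i => LinearMap.ker (A.mulVecLin ^ i), ?_, ?_, fun i _ => hA i, ?_, ?_⟩
    · exact LinearMap.ker_eq_bot.2 fun x y h => h
    · apply Submodule.eq_top_of_finrank_eq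
      rw [hA, numeric n f hf hfs hfn]
      simp
    · intro i _ x hx
      rw [LinearMap.mem_ker] at hx ⊢
      rw [pow_succ', Module.End.mul_apply, hx, map_zero]
    · rintro i h1 _ _ ⟨x, hx, rfl⟩
      obtain ⟨k, rfl⟩ : ∃ k, i = k + 1 := ⟨i - 1, by omega⟩
      rw [SetLike.mem_coe, LinearMap.mem_ker, pow_succ] at hx
      exact hx
end

section
/- Let Q be an invertible antisymmetric 2n×2n complex matrix and let H ∈ M_{2n}(ℂ) satisfy rank H = 1 and HᵀQ + QH = 0. Then there exists a vector u ∈ ℂ²ⁿ such that H = u·(Qu)ᵀ (the outer product of u with Qu). In other words, every rank-one element of the symplectic Lie algebra sp₂ₙ is of the form u(Qu)ᵀ. -/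
open Matrix

/-- Every rank-one element of the symplectic Lie algebra `sp₂ₙ` is of the form
`u·(Qu)ᵀ`: if `Q` is an invertible antisymmetric `2n×2n` complex matrix and
`H` has rank 1 with `HᵀQ + QH = 0`, then `H = u(Qu)ᵀ` for some vector `u`. -/
theorem rank_one_symplectic_form (n : ℕ) (hn : 1 ≤ n)
    (Q : Matrix (Fin (2 * n)) (Fin (2 * n)) ℂ)
    (hQinv : IsUnit Q) (hQanti : Qᵀ = -Q)
    (H : Matrix (Fin (2 * n)) (Fin (2 * n)) ℂ)
    (hrank : H.rank = 1) (hH : Hᵀ * Q + Q * H = 0) :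
    ∃ u : Fin (2 * n) → ℂ, H = vecMulVec u (Q.mulVec u) := by
  have hr : Module.finrank ℂ (LinearMap.range H.mulVecLin) = 1 := hrank
  obtain ⟨v, hv0, hv⟩ := finrank_eq_one_iff'.mp hr
  obtain ⟨a, ha⟩ := v
  have ha0 : a ≠ 0 := fun h => hv0 (by simp [h])
  have hcol : ∀ j, ∃ c : ℂ, ∀ i, H i j = c * a i := by
    intro j
    obtain ⟨c, hc⟩ := hv ⟨H.mulVecLin (Pi.single j 1), LinearMap.mem_range_self _ _⟩
    refine ⟨c, fun i => ?_⟩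
    have h1 := congrFun (congrArg Subtype.val hc) i
    simpa using h1.symm
  choose b hb using hcol
  have hHab : H = vecMulVec a b := by
    ext i j
    rw [hb, vecMulVec_apply, mul_comm]
  have haQ : a ᵥ* Q = -(Q *ᵥ a) := by
    rw [← mulVec_transpose, hQanti, neg_mulVec]
  have hw0 : Q *ᵥ a ≠ 0 := by
    intro h
    apply ha0
    apply Matrix.mulVec_injective_of_isUnit hQinv
    simpa using h
  rw [hHab, transpose_vecMulVec, vecMulVec_mul, mul_vecMulVec, haQ] at hH
  obtain ⟨i, hi⟩ := Function.ne_iff.mp hw0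
  simp only [Pi.zero_apply] at hi
  obtain ⟨s, hs⟩ := IsAlgClosed.exists_pow_nat_eq (b i / (Q *ᵥ a) i) (n := 2) (by norm_num)
  refine ⟨s • a, ?_⟩
  rw [hHab, mulVec_smul]
  ext k j
  have h2 := congrFun (congrFun hH i) j
  simp only [Matrix.add_apply, vecMulVec_apply, Pi.neg_apply, Matrix.zero_apply] at h2
  have h3 : b j = s ^ 2 * (Q *ᵥ a) j := by
    rw [hs]
    field_simp
    linear_combination h2
  simp only [vecMulVec_apply, Pi.smul_apply, smul_eq_mul]
  rw [h3]
  ring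
end

section
/- Let n ≥ 2 and let x be a nilpotent endomorphism of ℂⁿ of Jordan type (n−1, 1), i.e., rank x = n − 2 and x^{n−2} ≠ 0. Then a complete flag 0 = F₀ ⊂ F₁ ⊂ ⋯ ⊂ Fₙ = ℂⁿ (with dim Fⱼ = j) satisfies x(Fⱼ) ⊆ F_{j−1} for all 1 ≤ j ≤ n if and only if there exists i ∈ {1, …, n−1} such that Fⱼ = im(x^{n−1−j}) for all 1 ≤ j ≤ i−1 and Fⱼ = ker(x^{j−1}) for all i+1 ≤ j ≤ n. That is, the Springer fiber over a subregular nilpotent element of sl_n is the union of the n−1 families L₁, …, L_{n−1} of flags (each a projective line, parametrized by the free choice of Fᵢ). -/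
theorem range_pow_succ_eq_map {V : Type*} [AddCommGroup V] [Module ℂ V]
    (x : Module.End ℂ V) (k : ℕ) :
    LinearMap.range (x ^ (k + 1)) = Submodule.map x (LinearMap.range (x ^ k)) := by
  rw [pow_succ', Module.End.mul_eq_comp, LinearMap.range_comp]

theorem finrank_range_pow_lt {V : Type*} [AddCommGroup V] [Module ℂ V] [FiniteDimensional ℂ V]
    (x : Module.End ℂ V) (hnil : IsNilpotent x) (k : ℕ) (hk : x ^ k ≠ 0) :
    Module.finrank ℂ (LinearMap.range (x ^ (k + 1))) <
      Module.finrank ℂ (LinearMap.range (x ^ k)) := by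
  have hle : LinearMap.range (x ^ (k + 1)) ≤ LinearMap.range (x ^ k) := by
    rw [pow_succ, Module.End.mul_eq_comp]
    exact LinearMap.range_comp_le_range _ _
  apply Submodule.finrank_lt_finrank_of_lt
  refine lt_of_le_of_ne hle ?_
  intro heq
  have hst : ∀ m, LinearMap.range (x ^ (k + m)) = LinearMap.range (x ^ k) := by
    intro m
    induction m with
    | zero => rfl
    | succ m ih =>
      rw [← add_assoc, range_pow_succ_eq_map, ih, ← range_pow_succ_eq_map, heq]
  obtain ⟨N, hN⟩ := hnil
  have h := hst N
  rw [pow_add, hN, mul_zero, LinearMap.range_zero] at h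
  exact hk (LinearMap.range_eq_bot.mp h.symm)

/-- Description of the Springer fiber over a subregular nilpotent element of
`sl_n`.  Let `n ≥ 2` and let `x` be a nilpotent endomorphism of `ℂⁿ` of Jordan
type `(n-1, 1)`, i.e. `rank x = n - 2` and `x^{n-2} ≠ 0`.  A complete flag
`0 = F₀ ⊂ F₁ ⊂ ⋯ ⊂ Fₙ = ℂⁿ` satisfies `x(Fⱼ) ⊆ F_{j-1}` for all `1 ≤ j ≤ n`
iff there is `i ∈ {1, …, n-1}` with `Fⱼ = im(x^{n-1-j})` for `1 ≤ j ≤ i-1` and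
`Fⱼ = ker(x^{j-1})` for `i+1 ≤ j ≤ n`.  Thus the Springer fiber is the union
of the `n-1` families `L₁, …, L_{n-1}` of flags (each a projective line). -/
theorem subregular_springer_fiber
    (n : ℕ) (hn : 2 ≤ n) (x : Module.End ℂ (Fin n → ℂ))
    (hnil : IsNilpotent x)
    (hrank : Module.finrank ℂ (LinearMap.range x) = n - 2)
    (hpow : x ^ (n - 2) ≠ 0)
    (F : ℕ → Submodule ℂ (Fin n → ℂ))
    (hF0 : F 0 = ⊥) (hFn : F n = ⊤)
    (hdim : ∀ j ≤ n, Module.finrank ℂ (F j) = j)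
    (hmono : ∀ j < n, F j ≤ F (j + 1)) :
    (∀ j, 1 ≤ j → j ≤ n → Submodule.map x (F j) ≤ F (j - 1)) ↔
    (∃ i, 1 ≤ i ∧ i ≤ n - 1 ∧
      (∀ j, 1 ≤ j → j ≤ i - 1 → F j = LinearMap.range (x ^ (n - 1 - j))) ∧
      (∀ j, i + 1 ≤ j → j ≤ n → F j = LinearMap.ker (x ^ (j - 1)))) := by
  have hV : Module.finrank ℂ (Fin n → ℂ) = n := by simp
  have hne : ∀ k, k ≤ n - 2 → x ^ k ≠ 0 := by
    intro k hk h
    exact hpow (pow_eq_zero_of_le hk h)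
  have hlow : ∀ d, d ≤ n - 2 →
      d + 1 ≤ Module.finrank ℂ (LinearMap.range (x ^ (n - 2 - d))) := by
    intro d
    induction d with
    | zero =>
      intro _
      have : LinearMap.range (x ^ (n - 2)) ≠ ⊥ := fun h => hpow (LinearMap.range_eq_bot.mp h)
      have := (Submodule.one_le_finrank_iff).mpr this
      simpa using this
    | succ d ih =>
      intro hd
      have h1 := ih (by omega)
      have h2 := finrank_range_pow_lt x hnil (n - 2 - (d + 1)) (hne _ (by omega))
      rw [show n - 2 - (d + 1) + 1 = n - 2 - d by omega] at h2
      omega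
  have hup : ∀ k, k + 1 ≤ n - 1 →
      Module.finrank ℂ (LinearMap.range (x ^ (k + 1))) ≤ n - 1 - (k + 1) := by
    intro k
    induction k with
    | zero => intro _; rw [zero_add, pow_one, hrank]; omega
    | succ k ih =>
      intro hk
      have h1 := ih (by omega)
      have h2 := finrank_range_pow_lt x hnil (k + 1) (hne _ (by omega))
      omega
  have hr : ∀ k, 1 ≤ k → k ≤ n - 1 →
      Module.finrank ℂ (LinearMap.range (x ^ k)) = n - 1 - k := by
    intro k hk1 hk2
    obtain ⟨m, rfl⟩ : ∃ m, k = m + 1 := ⟨k - 1, by omega⟩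
    have h1 := hup m hk2
    by_cases h : m + 1 = n - 1
    · omega
    · have h2 := hlow (n - 2 - (m + 1)) (by omega)
      rw [show n - 2 - (n - 2 - (m + 1)) = m + 1 by omega] at h2
      omega
  have hzero : x ^ (n - 1) = 0 := by
    have h := hr (n - 1) (by omega) le_rfl
    rw [Nat.sub_self] at h
    exact LinearMap.range_eq_bot.mp (Submodule.finrank_eq_zero.mp h)
  have hk : ∀ k, 1 ≤ k → k ≤ n - 1 →
      Module.finrank ℂ (LinearMap.ker (x ^ k)) = k + 1 := by
    intro k hk1 hk2
    have h1 := LinearMap.finrank_range_add_finrank_ker (x ^ k)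
    rw [hr k hk1 hk2, hV] at h1
    omega
  have hIK : ∀ j, j ≤ n - 1 →
      LinearMap.range (x ^ (n - 1 - j)) ≤ LinearMap.ker (x ^ j) := by
    intro j hj
    rw [LinearMap.range_le_ker_iff, ← Module.End.mul_eq_comp, ← pow_add,
      show j + (n - 1 - j) = n - 1 by omega, hzero]
  have hmapker : ∀ k, Submodule.map x (LinearMap.ker (x ^ (k + 1))) ≤ LinearMap.ker (x ^ k) := by
    rintro k _ ⟨v, hv, rfl⟩
    have hv' : (x ^ (k + 1)) v = 0 := hv
    rw [pow_succ] at hv'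
    exact hv'
  have htop : LinearMap.ker (x ^ (n - 1)) = ⊤ := by rw [hzero, LinearMap.ker_zero]
  constructor
  · intro hS
    have hFK : ∀ j, j ≤ n → F j ≤ LinearMap.ker (x ^ j) := by
      intro j
      induction j with
      | zero => intro _; rw [hF0]; exact bot_le
      | succ j ih =>
        intro hj v hv
        have h1 : x v ∈ F j := hS (j + 1) (by omega) hj ⟨v, hv, rfl⟩
        have h2 : (x ^ j) (x v) = 0 := ih (by omega) h1
        rw [LinearMap.mem_ker, pow_succ]
        exact h2
    have hIF : ∀ m, m ≤ n → LinearMap.range (x ^ m) ≤ F (n - m) := by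
      intro m
      induction m with
      | zero => intro _; rw [Nat.sub_zero, hFn]; exact le_top
      | succ m ih =>
        intro hm
        rw [range_pow_succ_eq_map]
        refine (Submodule.map_mono (ih (by omega))).trans ?_
        exact hS (n - m) (by omega) (by omega)
    have hstep : ∀ j, 1 ≤ j → j ≤ n - 1 → F j ≠ LinearMap.range (x ^ (n - 1 - j)) →
        F (j + 1) = LinearMap.ker (x ^ j) := by
      intro j hj1 hj2 hj
      by_cases hjn : j = n - 1
      · rw [hjn, htop, show n - 1 + 1 = n by omega, hFn]
      · have hI : LinearMap.range (x ^ (n - 1 - j)) ≤ F (j + 1) := by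
          have := hIF (n - 1 - j) (by omega)
          rwa [show n - (n - 1 - j) = j + 1 by omega] at this
        have hrI := hr (n - 1 - j) (by omega) (by omega)
        have hdj := hdim j (by omega)
        have hdj1 := hdim (j + 1) (by omega)
        have hlt : F j < F j ⊔ LinearMap.range (x ^ (n - 1 - j)) := by
          refine lt_of_le_of_ne le_sup_left fun h => hj ?_
          have h2 : LinearMap.range (x ^ (n - 1 - j)) ≤ F j := by
            rw [h]; exact le_sup_right
          exact (Submodule.eq_of_le_of_finrank_eq h2 (by omega)).symm
        have h3 := Submodule.finrank_lt_finrank_of_lt hlt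
        have h4 : F j ⊔ LinearMap.range (x ^ (n - 1 - j)) = F (j + 1) :=
          Submodule.eq_of_le_of_finrank_le (sup_le (hmono j (by omega)) hI) (by omega)
        have h5 : F (j + 1) ≤ LinearMap.ker (x ^ j) := by
          rw [← h4]
          exact sup_le (hFK j (by omega)) (hIK j hj2)
        exact Submodule.eq_of_le_of_finrank_eq h5 (by rw [hdj1, hk j hj1 hj2])
    classical
    have hex : ∃ i, 1 ≤ i ∧ i ≤ n - 1 ∧ F i ≠ LinearMap.range (x ^ (n - 1 - i)) := by
      refine ⟨n - 1, by omega, le_rfl, fun h => ?_⟩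
      have h1 := hdim (n - 1) (by omega)
      rw [h, Nat.sub_self, pow_zero, Module.End.one_eq_id, LinearMap.range_id, finrank_top,
        hV] at h1
      omega
    obtain ⟨hi1, hi2, hi3⟩ := Nat.find_spec hex
    have hmin := fun m (hm : m < Nat.find hex) => Nat.find_min hex hm
    generalize Nat.find hex = i at hi1 hi2 hi3 hmin
    refine ⟨i, hi1, hi2, ?_, ?_⟩
    · intro j hj1 hj2
      by_contra hj
      exact hmin j (by omega) ⟨hj1, by omega, hj⟩
    · intro j hj
      induction j, hj using Nat.le_induction with
      | base => intro _; exact hstep i hi1 hi2 hi3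
      | succ j hj ih =>
        intro hjn
        have h1 := ih (by omega)
        refine hstep j (by omega) (by omega) fun h2 => hpow ?_
        rw [h1] at h2
        have h3 : LinearMap.range (x ^ (n - 1 - j)) ≤ LinearMap.ker (x ^ (j - 1)) := h2.ge
        rw [LinearMap.range_le_ker_iff, ← Module.End.mul_eq_comp, ← pow_add,
          show j - 1 + (n - 1 - j) = n - 2 by omega] at h3
        exact h3
  · rintro ⟨i, hi1, hi2, hA, hB⟩ j hj1 hjn
    have hpred : F (i - 1) = LinearMap.range (x ^ (n - i)) := by
      by_cases h : i = 1
      · rw [h, Nat.sub_self, hF0, hzero, LinearMap.range_zero]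
      · rw [hA (i - 1) (by omega) le_rfl, show n - 1 - (i - 1) = n - i by omega]
    have hkey : Submodule.map x (LinearMap.ker (x ^ i)) ≤ F (i - 1) := by
      rw [hpred]
      have hle : LinearMap.range (x ^ (n - i)) ≤ Submodule.map x (LinearMap.ker (x ^ i)) := by
        rw [show n - i = n - 1 - i + 1 by omega, range_pow_succ_eq_map]
        exact Submodule.map_mono (hIK i hi2)
      have hkk : LinearMap.ker x ≤ LinearMap.ker (x ^ i) := by
        intro v hv
        have hv' : x v = 0 := hv
        rw [LinearMap.mem_ker, show i = i - 1 + 1 by omega, pow_succ, Module.End.mul_apply, hv',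
          map_zero]
      have h1 := LinearMap.finrank_range_add_finrank_ker (x.domRestrict (LinearMap.ker (x ^ i)))
      rw [LinearMap.range_domRestrict, LinearMap.ker_domRestrict, hk i hi1 hi2,
        (Submodule.comapSubtypeEquivOfLe hkk).finrank_eq] at h1
      have h2 := hk 1 le_rfl (by omega)
      rw [pow_one] at h2
      have h3 := hr (n - i) (by omega) (by omega)
      exact (Submodule.eq_of_le_of_finrank_eq hle (by omega)).ge
    have hnext : F (i + 1) = LinearMap.ker (x ^ i) := hB (i + 1) le_rfl (by omega)
    rcases lt_trichotomy j i with h | h | h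
    · rw [hA j hj1 (by omega), ← range_pow_succ_eq_map]
      by_cases h1 : j = 1
      · rw [h1, show n - 1 - 1 + 1 = n - 1 by omega, hzero, LinearMap.range_zero]
        exact bot_le
      · rw [hA (j - 1) (by omega) (by omega), show n - 1 - j + 1 = n - 1 - (j - 1) by omega]
    · rw [h]
      refine (Submodule.map_mono (hmono i (by omega))).trans ?_
      rw [hnext]
      exact hkey
    · by_cases h1 : j = i + 1
      · rw [h1, hnext]
        refine hkey.trans ?_
        have := hmono (i - 1) (by omega)
        rwa [show i - 1 + 1 = i by omega] at this
      · rw [hB j (by omega) hjn, hB (j - 1) (by omega) (by omega),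
          show j - 1 = j - 1 - 1 + 1 by omega]
        exact hmapker _
end

section
/- Let x be an endomorphism of ℂⁿ possessing n distinct eigenvalues. Then the set of complete flags 0 = F₀ ⊂ F₁ ⊂ ⋯ ⊂ Fₙ = ℂⁿ (with dim Fⱼ = j) such that x(Fⱼ) ⊆ Fⱼ for all j is finite of cardinality exactly n!. That is, the fiber of the Grothendieck–Springer map over a regular semisimple element is a torsor for the symmetric group on the eigenvalues. -/
theorem gs_coord_mem {n : ℕ} (x : Module.End ℂ (Fin n → ℂ)) (μ : Fin n → ℂ)
    (hinj : Function.Injective μ) (b : Module.Basis (Fin n) ℂ (Fin n → ℂ))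
    (hb : ∀ i, x.HasEigenvector (μ i) (b i)) (p : Submodule ℂ (Fin n → ℂ))
    (hp : Submodule.map x p ≤ p) (v : Fin n → ℂ) (hv : v ∈ p) (i : Fin n)
    (hi : b.repr v i ≠ 0) : b i ∈ p := by
  have hmem : ∀ q : Polynomial ℂ, ∀ w ∈ p, Polynomial.aeval x q w ∈ p := by
    intro q
    induction q using Polynomial.induction_on with
    | C a =>
      intro w hw
      simpa [Module.algebraMap_end_apply] using p.smul_mem a hw
    | add f g hf hg =>
      intro w hw
      simpa using p.add_mem (hf w hw) (hg w hw)
    | monomial k a h =>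
      intro w hw
      have h1 := h (x w) (hp ⟨w, hw, rfl⟩)
      rw [pow_succ, ← mul_assoc, map_mul, Polynomial.aeval_X]
      exact h1
  have h1 := hmem (Lagrange.basis Finset.univ μ i) v hv
  have h2 : Polynomial.aeval x (Lagrange.basis Finset.univ μ i) v = b.repr v i • b i := by
    conv_lhs => rw [← b.sum_repr v]
    rw [map_sum, Finset.sum_eq_single i]
    · rw [map_smul, Module.End.aeval_apply_of_hasEigenvector (hb i),
        Lagrange.eval_basis_self hinj.injOn (Finset.mem_univ i), one_smul]
    · intro k _ hk
      rw [map_smul, Module.End.aeval_apply_of_hasEigenvector (hb k),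
        Lagrange.eval_basis_of_ne hk.symm (Finset.mem_univ k), zero_smul, smul_zero]
    · simp
  rw [h2] at h1
  exact (p.smul_mem_iff hi).1 h1

theorem gs_eq_span {n : ℕ} (x : Module.End ℂ (Fin n → ℂ)) (μ : Fin n → ℂ)
    (hinj : Function.Injective μ) (b : Module.Basis (Fin n) ℂ (Fin n → ℂ))
    (hb : ∀ i, x.HasEigenvector (μ i) (b i)) (p : Submodule ℂ (Fin n → ℂ))
    (hp : Submodule.map x p ≤ p) : p = Submodule.span ℂ (b '' {i | b i ∈ p}) := by
  apply le_antisymm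
  · intro v hv
    rw [← b.sum_repr v]
    refine Submodule.sum_mem _ fun i _ => ?_
    by_cases hi : b.repr v i = 0
    · simp [hi]
    · exact Submodule.smul_mem _ _ (Submodule.subset_span
        ⟨i, gs_coord_mem x μ hinj b hb p hp v hv i hi, rfl⟩)
  · rw [Submodule.span_le]
    rintro _ ⟨i, hi, rfl⟩
    exact hi

theorem gs_finrank {n : ℕ} (b : Module.Basis (Fin n) ℂ (Fin n → ℂ)) (S : Set (Fin n)) :
    Module.finrank ℂ (Submodule.span ℂ (b '' S)) = S.ncard := by
  classical
  have h := finrank_span_set_eq_card (b.linearIndependent.linearIndepOn_id.mono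
    (Set.image_subset_range b S))
  rw [h, ← Set.ncard_eq_toFinset_card', Set.ncard_image_of_injective _ b.injective]

theorem gs_ncard {n : ℕ} (σ : Equiv.Perm (Fin n)) (j : Fin (n + 1)) :
    {i | (σ i : ℕ) < (j : ℕ)}.ncard = (j : ℕ) := by
  have h : {i | (σ i : ℕ) < (j : ℕ)} = σ.symm '' {i : Fin n | (i : ℕ) < (j : ℕ)} := by
    ext i
    simp [Equiv.symm_apply_eq]
  rw [h, Set.ncard_image_of_injective _ σ.symm.injective]
  have h2 := Set.ncard_image_of_injective {i : Fin n | (i : ℕ) < (j : ℕ)} Fin.val_injective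
  rw [← h2]
  have h3 : Fin.val '' {i : Fin n | (i : ℕ) < (j : ℕ)} = ((Finset.range (j : ℕ) : Finset ℕ) : Set ℕ) := by
    ext k
    simp only [Set.mem_image, Set.mem_setOf_eq, Finset.coe_range, Set.mem_Iio]
    constructor
    · rintro ⟨i, hi, rfl⟩
      exact hi
    · intro hk
      exact ⟨⟨k, by omega⟩, hk, rfl⟩
  rw [h3, Set.ncard_coe_finset, Finset.card_range]

/-- The fiber of the Grothendieck–Springer map over a regular semisimple
element is a torsor for the symmetric group on the eigenvalues: if `x` is an
endomorphism of `ℂⁿ` with `n` distinct eigenvalues, then the set of complete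
flags `0 = F₀ ⊂ F₁ ⊂ ⋯ ⊂ Fₙ = ℂⁿ` with `x(Fⱼ) ⊆ Fⱼ` for all `j` is finite of
cardinality exactly `n!`. -/
theorem grothendieck_springer_fiber_card
    (n : ℕ) (x : Module.End ℂ (Fin n → ℂ)) (μ : Fin n → ℂ)
    (hinj : Function.Injective μ)
    (heig : ∀ i, x.HasEigenvalue (μ i)) :
    Nat.card {F : Fin (n + 1) → Submodule ℂ (Fin n → ℂ) //
      F 0 = ⊥ ∧ F (Fin.last n) = ⊤ ∧
      (∀ j, Module.finrank ℂ (F j) = (j : ℕ)) ∧ Monotone F ∧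
      ∀ j, Submodule.map x (F j) ≤ F j} = Nat.factorial n := by
  classical
  choose v hv using fun i => (heig i).exists_hasEigenvector
  have hli : LinearIndependent ℂ v := Module.End.eigenvectors_linearIndependent' x μ hinj v hv
  obtain ⟨b, hb⟩ : ∃ b : Module.Basis (Fin n) ℂ (Fin n → ℂ),
      ∀ i, x.HasEigenvector (μ i) (b i) := by
    refine ⟨Module.Basis.mk hli (hli.span_eq_top_of_card_eq_finrank' (by simp)).ge, fun i => ?_⟩
    rw [Module.Basis.mk_apply]
    exact hv i
  have hmem : ∀ (S : Set (Fin n)) i, b i ∈ Submodule.span ℂ (b '' S) ↔ i ∈ S := by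
    intro S i
    exact b.self_mem_span_image
  let G : Equiv.Perm (Fin n) → {F : Fin (n + 1) → Submodule ℂ (Fin n → ℂ) //
      F 0 = ⊥ ∧ F (Fin.last n) = ⊤ ∧
      (∀ j, Module.finrank ℂ (F j) = (j : ℕ)) ∧ Monotone F ∧
      ∀ j, Submodule.map x (F j) ≤ F j} := fun σ =>
    ⟨fun j => Submodule.span ℂ (b '' {i | (σ i : ℕ) < (j : ℕ)}), by
      refine ⟨by simp, ?_, ?_, ?_, ?_⟩
      · have : {i | (σ i : ℕ) < ((Fin.last n : Fin (n + 1)) : ℕ)} = Set.univ := by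
          ext i; simp
        simp only [this, Set.image_univ, b.span_eq]
      · intro j
        rw [gs_finrank, gs_ncard]
      · intro j k hjk
        refine Submodule.span_mono (Set.image_mono fun i hi => ?_)
        have : (j : ℕ) ≤ k := hjk
        exact lt_of_lt_of_le hi this
      · intro j
        rw [Submodule.map_span_le]
        rintro _ ⟨i, hi, rfl⟩
        rw [(hb i).apply_eq_smul]
        exact Submodule.smul_mem _ _ (Submodule.subset_span ⟨i, hi, rfl⟩)⟩
  have hG : ∀ σ j i, b i ∈ (G σ).1 j ↔ (σ i : ℕ) < (j : ℕ) := fun σ j i => hmem _ i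
  have hbij : Function.Bijective G := by
    constructor
    · intro σ τ h
      ext i
      have h1 : ∀ j : Fin (n + 1), (σ i : ℕ) < (j : ℕ) ↔ (τ i : ℕ) < (j : ℕ) := by
        intro j
        rw [← hG, ← hG, h]
      have h2 := h1 (σ i).castSucc
      have h3 := h1 (τ i).castSucc
      simp only [Fin.val_castSucc] at h2 h3
      omega
    · rintro ⟨F, h0, hlast, hrank, hmono, hinv⟩
      have hspan := fun j => gs_eq_span x μ hinj b hb (F j) (hinv j)
      have hcard : ∀ j, {i | b i ∈ F j}.ncard = (j : ℕ) := by
        intro j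
        rw [← gs_finrank b, ← hspan, hrank]
      have hex : ∀ k : Fin n, ∃ i, b i ∈ F k.succ ∧ b i ∉ F k.castSucc := by
        intro k
        by_contra! hc
        have h1 := Set.ncard_le_ncard (s := {i | b i ∈ F k.succ})
          (t := {i | b i ∈ F k.castSucc}) hc (Set.toFinite _)
        rw [hcard, hcard] at h1
        simp at h1
      choose e he1 he2 using hex
      have hlt : ∀ k l : Fin n, k < l → e k ≠ e l := by
        intro k l hkl h
        apply he2 l
        rw [← h]
        exact hmono (show k.succ ≤ l.castSucc from Nat.succ_le_of_lt hkl) (he1 k)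
      have heinj : Function.Injective e := by
        intro k l h
        rcases lt_trichotomy k l with h1 | h1 | h1
        · exact (hlt _ _ h1 h).elim
        · exact h1
        · exact (hlt _ _ h1 h.symm).elim
      let ε : Equiv.Perm (Fin n) := Equiv.ofBijective e (Finite.injective_iff_bijective.1 heinj)
      refine ⟨ε.symm, Subtype.ext (funext fun j => ?_)⟩
      refine Eq.trans ?_ (hspan j).symm
      have : {i | (ε.symm i : ℕ) < (j : ℕ)} = {i | b i ∈ F j} := by
        ext i
        obtain ⟨k, rfl⟩ := ε.surjective i
        simp only [Set.mem_setOf_eq, Equiv.symm_apply_apply]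
        constructor
        · intro hk
          exact hmono (show k.succ ≤ j from Nat.succ_le_of_lt hk) (he1 k)
        · intro hk
          by_contra hc
          exact he2 k (hmono (show j ≤ k.castSucc from not_lt.1 hc) hk)
      change Submodule.span ℂ (b '' {i | (ε.symm i : ℕ) < (j : ℕ)}) = _
      rw [this]
  rw [← Nat.card_congr (Equiv.ofBijective G hbij), Nat.card_eq_fintype_card,
    Fintype.card_perm, Fintype.card_fin]
end
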